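/- Fix λ > 0, β₀ ∈ ℝ^{d(k+1)}, x ∈ ℝ^{k+1}, w ∈ ℝ, m ∈ ℝ, and set c = m π(β₀,x) ∈ ℝ^{d+1}. Then the map F : ℝ^{d(k+1)} → ℝ^{d(k+1)} defined by F(β) = [ w Δ*(π(β,x)) diag^{λ−1}(π(β,x)) (c − m π(β,x)) ] ⊗ x is differentiable at β₀, and its Jacobian there equals − Ψ_λ(β₀) where Ψ_λ(β₀) = [ w m Δ*(π(β₀,x)) diag^{λ−1}(π(β₀,x)) Δ*(π(β₀,x))ᵀ ] ⊗ (x xᵀ). (This is the computation of the expected negative Jacobian matrix of the minimum quasi weighted DPD estimating equation at the true parameter, used in Theorem 2 of the paper.) -/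

import Mathlib

open Real Matrix

noncomputable def plr (d k : ℕ) (β : Fin d → Fin (k + 1) → ℝ) (x : Fin (k + 1) → ℝ) :
    Fin (d + 1) → ℝ := fun r =>
  if h : (r : ℕ) < d then
    Real.exp (∑ u, x u * β ⟨r, h⟩ u) / (1 + ∑ l, Real.exp (∑ u, x u * β l u))
  else 1 / (1 + ∑ l, Real.exp (∑ u, x u * β l u))

noncomputable def DeltaMat {n : ℕ} (p : Fin n → ℝ) : Matrix (Fin n) (Fin n) ℝ :=
  Matrix.diagonal p - Matrix.of fun i j => p i * p j

noncomputable def DeltaStar (d : ℕ) (p : Fin (d + 1) → ℝ) : Matrix (Fin d) (Fin (d + 1)) ℝ :=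
  Matrix.of fun i j => DeltaMat p i.castSucc j

noncomputable def diagPow (lam : ℝ) {n : ℕ} (p : Fin n → ℝ) : Matrix (Fin n) (Fin n) ℝ :=
  Matrix.diagonal fun l => p l ^ (lam - 1)

theorem plr_hasFDerivAt (d k : ℕ) (β₀ : Fin d → Fin (k + 1) → ℝ) (x : Fin (k + 1) → ℝ)
    (r : Fin (d + 1)) :
    ∃ L : (Fin d → Fin (k + 1) → ℝ) →L[ℝ] ℝ, HasFDerivAt (fun β => plr d k β x r) L β₀ ∧
      ∀ v' u', L (Pi.single v' (Pi.single u' 1)) =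
        DeltaStar d (plr d k β₀ x) v' r * x u' := by
  let l : Fin d → (Fin d → Fin (k + 1) → ℝ) →L[ℝ] ℝ := fun v =>
    ∑ u, x u • (ContinuousLinearMap.proj (R := ℝ) (φ := fun _ : Fin (k + 1) => ℝ) u).comp
      (ContinuousLinearMap.proj (R := ℝ) (φ := fun _ : Fin d => Fin (k + 1) → ℝ) v)
  have hl : ∀ v β, l v β = ∑ u, x u * β v u := by
    intro v β; simp [l]
  have hls : ∀ v v' u', l v (Pi.single v' (Pi.single u' 1)) = if v = v' then x u' else 0 := by
    intro v v' u'
    rw [hl]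
    by_cases h : v = v'
    · subst h; simp [Pi.single_apply]
    · simp [h]
  have hE : ∀ v, HasFDerivAt (fun β : Fin d → Fin (k + 1) → ℝ => Real.exp (∑ u, x u * β v u))
      (Real.exp (∑ u, x u * β₀ v u) • l v) β₀ := by
    intro v
    have := (l v).hasFDerivAt (x := β₀) |>.exp
    simpa only [hl] using this
  have hS : HasFDerivAt (fun β : Fin d → Fin (k + 1) → ℝ =>
      1 + ∑ v, Real.exp (∑ u, x u * β v u))
      (∑ v, Real.exp (∑ u, x u * β₀ v u) • l v) β₀ :=
    (HasFDerivAt.fun_sum fun v _ => hE v).const_add 1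
  have hpos : (0:ℝ) < 1 + ∑ v, Real.exp (∑ u, x u * β₀ v u) := by positivity
  have hI := (hasDerivAt_inv hpos.ne').comp_hasFDerivAt β₀ hS
  have hsum : ∀ v' u', (∑ v, Real.exp (∑ u, x u * β₀ v u) • l v)
      (Pi.single v' (Pi.single u' 1)) = Real.exp (∑ u, x u * β₀ v' u) * x u' := by
    intro v' u'
    simp [hls]
  by_cases h : (r : ℕ) < d
  · refine ⟨_, (((hE ⟨r, h⟩).mul hI).congr_of_eventuallyEq (.of_forall fun β => ?_)), ?_⟩
    · simp [plr, h, div_eq_mul_inv]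
    · intro v' u'
      simp only [ContinuousLinearMap.add_apply, ContinuousLinearMap.smul_apply, hsum, hls,
        smul_eq_mul, DeltaStar, DeltaMat, Matrix.of_apply, Matrix.sub_apply,
        Matrix.diagonal_apply, plr, h, Fin.val_castSucc, v'.isLt, dif_pos, Function.comp]
      have e : (v'.castSucc = r) ↔ ((⟨r, h⟩ : Fin d) = v') := by
        simp only [Fin.ext_iff, Fin.val_castSucc]; exact eq_comm
      by_cases h2 : (⟨r, h⟩ : Fin d) = v'
      · simp only [e, h2, if_true]
        field_simp
        try ring
      · simp only [e, h2, if_false]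
        field_simp
        try ring
  · refine ⟨_, (hI.congr_of_eventuallyEq (.of_forall fun β => ?_)), ?_⟩
    · simp [plr, h]
    · intro v' u'
      have e : ¬ (v'.castSucc = r) := by
        intro e; apply h; rw [← e]; exact v'.isLt
      simp only [ContinuousLinearMap.smul_apply, hsum,
        smul_eq_mul, DeltaStar, DeltaMat, Matrix.of_apply, Matrix.sub_apply,
        Matrix.diagonal_apply, plr, h, Fin.val_castSucc, v'.isLt, dif_pos, e, if_false,
        dif_neg, not_false_eq_true]
      field_simp
      try ring

theorem plr_pos (d k : ℕ) (β : Fin d → Fin (k + 1) → ℝ) (x : Fin (k + 1) → ℝ)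
    (r : Fin (d + 1)) : 0 < plr d k β x r := by
  unfold plr
  split <;> positivity

/-- The map `F(β) = [w Δ*(π(β,x)) diag^{λ−1}(π(β,x)) (c − m π(β,x))] ⊗ x`, with
`c = m π(β₀,x)`, is differentiable at `β₀` with Jacobian `−Ψ_λ(β₀)` where
`Ψ_λ(β₀) = [w m Δ*(π(β₀,x)) diag^{λ−1}(π(β₀,x)) Δ*(π(β₀,x))ᵀ] ⊗ (x xᵀ)`. -/
theorem mdpde_expected_jacobian (d k : ℕ) (lam : ℝ) (hlam : 0 < lam)
    (β₀ : Fin d → Fin (k + 1) → ℝ) (x : Fin (k + 1) → ℝ) (w m : ℝ) :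
    letI c : Fin (d + 1) → ℝ := m • plr d k β₀ x
    letI F : (Fin d → Fin (k + 1) → ℝ) → Fin d → Fin (k + 1) → ℝ := fun β v u =>
      w * ((DeltaStar d (plr d k β x) * diagPow lam (plr d k β x)).mulVec
        (c - m • plr d k β x)) v * x u
    DifferentiableAt ℝ F β₀ ∧
    (∀ (v : Fin d) (u : Fin (k + 1)) (v' : Fin d) (u' : Fin (k + 1)),
      fderiv ℝ F β₀ (Pi.single v' (Pi.single u' 1)) v u =
        -(w * m *
          (DeltaStar d (plr d k β₀ x) * diagPow lam (plr d k β₀ x) *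
            (DeltaStar d (plr d k β₀ x))ᵀ) v v' * (x u * x u'))) := by
  set F : (Fin d → Fin (k + 1) → ℝ) → Fin d → Fin (k + 1) → ℝ := fun β v u =>
      w * ((DeltaStar d (plr d k β x) * diagPow lam (plr d k β x)).mulVec
        (m • plr d k β₀ x - m • plr d k β x)) v * x u with hFdef
  choose L hL hLs using fun r => plr_hasFDerivAt d k β₀ x r
  have hA : ∀ v j, DifferentiableAt ℝ (fun β => DeltaStar d (plr d k β x) v j *
      plr d k β x j ^ (lam - 1)) β₀ := by
    intro v j
    have hp := fun r => (hL r).differentiableAt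
    refine DifferentiableAt.mul ?_ ((hp j).rpow_const (Or.inl (plr_pos d k β₀ x j).ne'))
    simp only [DeltaStar, DeltaMat, Matrix.of_apply, Matrix.sub_apply, Matrix.diagonal_apply]
    refine DifferentiableAt.sub ?_ ((hp _).mul (hp _))
    split
    · exact hp _
    · exact differentiableAt_const _
  have hF : ∀ v u, HasFDerivAt (fun β => F β v u)
      (x u • w • ∑ j, (DeltaStar d (plr d k β₀ x) v j * plr d k β₀ x j ^ (lam - 1)) •
        (-(m • L j))) β₀ := by
    intro v u
    have h1 : ∀ j, HasFDerivAt (fun β => (DeltaStar d (plr d k β x) v j *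
        plr d k β x j ^ (lam - 1)) * (m * plr d k β₀ x j - m * plr d k β x j))
        ((DeltaStar d (plr d k β₀ x) v j * plr d k β₀ x j ^ (lam - 1)) • (-(m • L j))) β₀ := by
      intro j
      have := (hA v j).hasFDerivAt.fun_mul (((hL j).const_mul m).const_sub (m * plr d k β₀ x j))
      simpa using this
    have h2 := ((HasFDerivAt.fun_sum fun j (_ : j ∈ Finset.univ) => h1 j).const_mul w).mul_const (x u)
    refine h2.congr_of_eventuallyEq (.of_forall fun β => ?_)
    simp [F, diagPow, Matrix.mulVec, dotProduct, Matrix.mul_diagonal]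
  have hF' : HasFDerivAt F (ContinuousLinearMap.pi fun v => ContinuousLinearMap.pi fun u =>
      (x u • w • ∑ j, (DeltaStar d (plr d k β₀ x) v j * plr d k β₀ x j ^ (lam - 1)) •
        (-(m • L j)))) β₀ :=
    hasFDerivAt_pi.2 fun v => hasFDerivAt_pi.2 fun u => hF v u
  refine ⟨hF'.differentiableAt, fun v u v' u' => ?_⟩
  rw [hF'.fderiv]
  simp only [ContinuousLinearMap.pi_apply, ContinuousLinearMap.smul_apply,
    ContinuousLinearMap.sum_apply, ContinuousLinearMap.neg_apply, hLs, smul_eq_mul]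
  rw [Matrix.mul_apply]
  simp only [diagPow, Matrix.mul_diagonal, Matrix.transpose_apply, Finset.mul_sum,
    Finset.sum_mul, ← Finset.sum_neg_distrib]
  refine Finset.sum_congr rfl fun j _ => ?_
  ring
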